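/- Let G be a finite DAG with n nodes and maximum indegree Δ, and let R be such that R − 1 ≥ Δ + 1. Then in the oneshot model, opt(R − 1) ≤ opt(R) + 2n, i.e. reducing the number of available red pebbles by one increases the optimal pebbling cost by at most 2n. -/

import Mathlib

namespace RBPebble

open scoped Classical

/-- A pebble is either red (fast memory) or blue (slow memory). -/
inductive Peb : Type
  | red
  | blue
  deriving DecidableEq

/-- The four kinds of moves of a red-blue pebbling. -/
inductive Move (V : Type) : Type
  | toRed (v : V)    -- (1) replace a blue pebble by a red pebble
  | toBlue (v : V)   -- (2) replace a red pebble by a blue pebble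
  | compute (v : V)  -- (3) place a red pebble on a node whose in-neighbors are all red
  | delete (v : V)   -- (4) delete a pebble
  deriving DecidableEq

variable {V : Type}

/-- A configuration assigns to each node no pebble, a red pebble, or a blue pebble. -/
def Config (V : Type) : Type := V → Option Peb

/-- The initial configuration: no pebbles anywhere. -/
def initConfig : Config V := fun _ => none

/-- The effect of a move on a configuration. -/
def applyMove [DecidableEq V] (c : Config V) : Move V → Config V
  | .toRed v => Function.update c v (some Peb.red)
  | .toBlue v => Function.update c v (some Peb.blue)
  | .compute v => Function.update c v (some Peb.red)
  | .delete v => Function.update c v none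

/-- The number of red pebbles in a configuration. -/
noncomputable def redCount [Fintype V] (c : Config V) : ℕ :=
  (Finset.univ.filter fun v => c v = some Peb.red).card

/-- Legality of a move in a given configuration (base model). -/
def legalMove (edge : V → V → Prop) (c : Config V) : Move V → Prop
  | .toRed v => c v = some Peb.blue
  | .toBlue v => c v = some Peb.red
  | .compute v => ∀ u, edge u v → c u = some Peb.red
  | .delete v => c v ≠ none

/-- A sequence of moves is valid from a configuration: every move is legal and
at every point at most `R` red pebbles are on the graph. -/
def ValidFrom [Fintype V] [DecidableEq V] (edge : V → V → Prop) (R : ℕ) :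
    Config V → List (Move V) → Prop
  | _, [] => True
  | c, m :: ms =>
      legalMove edge c m ∧ redCount (applyMove c m) ≤ R ∧
        ValidFrom edge R (applyMove c m) ms

/-- Running a list of moves from a configuration. -/
def runMoves [DecidableEq V] (c : Config V) : List (Move V) → Config V
  | [] => c
  | m :: ms => runMoves (applyMove c m) ms

/-- A sink: a node with no outgoing edge. -/
def IsSink (edge : V → V → Prop) (v : V) : Prop := ∀ u, ¬ edge v u

/-- A source: a node with no incoming edge. -/
def IsSource (edge : V → V → Prop) (v : V) : Prop := ∀ u, ¬ edge u v

/-- A valid pebbling of the DAG with `R` red pebbles: starts from the empty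
configuration, is valid throughout, and in the final configuration every sink
carries a pebble (of either color). -/
def IsPebbling [Fintype V] [DecidableEq V] (edge : V → V → Prop) (R : ℕ)
    (moves : List (Move V)) : Prop :=
  ValidFrom edge R initConfig moves ∧
    ∀ v, IsSink edge v → runMoves initConfig moves v ≠ none

def isTransfer : Move V → Bool
  | .toRed _ => true
  | .toBlue _ => true
  | _ => false

def isCompute : Move V → Bool
  | .compute _ => true
  | _ => false

def isDelete : Move V → Bool
  | .delete _ => true
  | _ => false

/-- The cost of a pebbling: the number of moves of types (1) and (2). -/
def cost (moves : List (Move V)) : ℕ := (moves.filter isTransfer).length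

/-- The number of compute moves (type (3)). -/
def computeCount (moves : List (Move V)) : ℕ := (moves.filter isCompute).length

/-- The number of delete moves (type (4)). -/
def deleteCount (moves : List (Move V)) : ℕ := (moves.filter isDelete).length

/-- The cost in the compcost model: transfers plus `ε` times the computes. -/
noncomputable def ccCost (ε : ℝ) (moves : List (Move V)) : ℝ :=
  (cost moves : ℝ) + ε * (computeCount moves : ℝ)

/-- The oneshot restriction: each node is computed at most once. -/
def Oneshot [DecidableEq V] (moves : List (Move V)) : Prop :=
  ∀ v : V, moves.count (Move.compute v) ≤ 1

/-- The nodel restriction: no delete moves are used. -/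
def NoDel (moves : List (Move V)) : Prop := ∀ m ∈ moves, isDelete m = false

/-- The indegree of a node. -/
noncomputable def indeg [Fintype V] (edge : V → V → Prop) (v : V) : ℕ :=
  (Finset.univ.filter fun u => edge u v).card

/-- The edge relation is acyclic (the graph is a DAG). -/
def Acyclic (edge : V → V → Prop) : Prop :=
  ∀ v, ¬ Relation.TransGen edge v v

/-- The optimal cost of a valid pebbling with `R` red pebbles in the oneshot model. -/
noncomputable def optCost [Fintype V] [DecidableEq V] (edge : V → V → Prop) (R : ℕ) : ℕ :=
  sInf {c | ∃ moves : List (Move V),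
    IsPebbling edge R moves ∧ Oneshot moves ∧ cost moves = c}

lemma cost_append (l₁ l₂ : List (Move V)) : cost (l₁ ++ l₂) = cost l₁ + cost l₂ := by
  simp [cost]

lemma computeCount_append (l₁ l₂ : List (Move V)) :
    computeCount (l₁ ++ l₂) = computeCount l₁ + computeCount l₂ := by
  simp [computeCount]

section Config

variable [DecidableEq V]

/-- Change the pebble at a single node. -/
def Config.put (c : Config V) (v : V) (p : Option Peb) : Config V := Function.update c v p

lemma Config.put_apply (c : Config V) (v : V) (p : Option Peb) (u : V) :
    c.put v p u = if u = v then p else c u :=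
  Function.update_apply c v p u

@[simp]
lemma Config.put_self (c : Config V) (v : V) (p : Option Peb) : c.put v p v = p :=
  Function.update_self (β := fun _ => Option Peb) v p c

@[simp]
lemma Config.put_of_ne {u v : V} (h : u ≠ v) (c : Config V) (p : Option Peb) :
    c.put v p u = c u :=
  Function.update_of_ne (β := fun _ => Option Peb) h p c

@[simp]
lemma Config.put_put (c : Config V) (v : V) (p q : Option Peb) :
    (c.put v p).put v q = c.put v q :=
  Function.update_idem (β := fun _ => Option Peb) p q c

@[simp]
lemma Config.put_eq_self (c : Config V) (v : V) : c.put v (c v) = c :=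
  Function.update_eq_self v c

lemma Config.put_comm {u v : V} (h : u ≠ v) (c : Config V) (p q : Option Peb) :
    (c.put u p).put v q = (c.put v q).put u p :=
  Function.update_comm (β := fun _ => Option Peb) h p q c

@[simp]
lemma applyMove_toRed (c : Config V) (v : V) : applyMove c (.toRed v) = c.put v (some Peb.red) :=
  rfl

@[simp]
lemma applyMove_toBlue (c : Config V) (v : V) :
    applyMove c (.toBlue v) = c.put v (some Peb.blue) :=
  rfl

@[simp]
lemma applyMove_compute (c : Config V) (v : V) :
    applyMove c (.compute v) = c.put v (some Peb.red) :=
  rfl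

@[simp]
lemma applyMove_delete (c : Config V) (v : V) : applyMove c (.delete v) = c.put v none :=
  rfl

lemma runMoves_append (c : Config V) (l₁ l₂ : List (Move V)) :
    runMoves c (l₁ ++ l₂) = runMoves (runMoves c l₁) l₂ := by
  induction l₁ generalizing c with
  | nil => rfl
  | cons m ms ih => exact ih _

/-- The configuration `s` agrees with `c`, except that at most one red pebble of `c` is blue
in `s`. -/
def Shadows (c s : Config V) : Prop :=
  s = c ∨ ∃ h, c h = some Peb.red ∧ s = c.put h (some Peb.blue)

lemma Shadows.ne_none {c s : Config V} (h : Shadows c s) {v : V} (hv : c v ≠ none) :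
    s v ≠ none := by
  rcases h with rfl | ⟨w, -, rfl⟩
  · exact hv
  · rcases eq_or_ne v w with rfl | hne
    · simp
    · simpa [hne] using hv

end Config

section RedCount

variable [Fintype V]

lemma redCount_mono {c d : Config V} (h : ∀ v, c v = some Peb.red → d v = some Peb.red) :
    redCount c ≤ redCount d :=
  Finset.card_le_card fun v hv => by
    simp only [Finset.mem_filter, Finset.mem_univ, true_and] at hv ⊢
    exact h v hv

lemma redCount_lt {c d : Config V} (h : ∀ v, c v = some Peb.red → d v = some Peb.red) {w : V}
    (hd : d w = some Peb.red) (hc : c w ≠ some Peb.red) : redCount c < redCount d :=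
  Finset.card_lt_card <| Finset.ssubset_iff_of_subset (fun v hv => by
    simp only [Finset.mem_filter, Finset.mem_univ, true_and] at hv ⊢
    exact h v hv) |>.2 ⟨w, by simpa using hd, by simpa using hc⟩

lemma redCount_initConfig : redCount (initConfig : Config V) = 0 := by
  simp [redCount, initConfig]

end RedCount

variable [Fintype V] [DecidableEq V]

/-- If there are more than `indeg v + 1` red pebbles, one of them lies neither on `v` nor on an
in-neighbor of `v`. -/
lemma exists_red_not_edge {edge : V → V → Prop} {d : Config V} {v : V}
    (h : indeg edge v + 1 < redCount d) :
    ∃ w, d w = some Peb.red ∧ w ≠ v ∧ ¬ edge w v := by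
  by_contra! hcon
  have hsub : (Finset.univ.filter fun w => d w = some Peb.red) ⊆
      insert v (Finset.univ.filter fun u => edge u v) := by
    intro w hw
    simp only [Finset.mem_filter, Finset.mem_univ, true_and, Finset.mem_insert] at hw ⊢
    by_cases hwv : w = v
    · exact Or.inl hwv
    · exact Or.inr (hcon w hw hwv)
  have hcard := (Finset.card_le_card hsub).trans (Finset.card_insert_le _ _)
  simp only [redCount, indeg] at h
  omega

lemma ValidFrom.mono {edge : V → V → Prop} {R R' : ℕ} (hR : R ≤ R') {c : Config V}
    {ms : List (Move V)} (h : ValidFrom edge R c ms) : ValidFrom edge R' c ms := by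
  induction ms generalizing c with
  | nil => trivial
  | cons m ms ih => exact ⟨h.1, h.2.1.trans hR, ih h.2.2⟩

lemma ValidFrom.append {edge : V → V → Prop} {R : ℕ} {c : Config V} {l₁ l₂ : List (Move V)}
    (h₁ : ValidFrom edge R c l₁) (h₂ : ValidFrom edge R (runMoves c l₁) l₂) :
    ValidFrom edge R c (l₁ ++ l₂) := by
  induction l₁ generalizing c with
  | nil => exact h₂
  | cons m ms ih => exact ⟨h₁.1, h₁.2.1, ih h₁.2.2 h₂⟩

/-- The move list `ms` takes `s` with `K` red pebbles to a configuration shadowing the target. -/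
def Simulates (edge : V → V → Prop) (K : ℕ) (s c' : Config V) (ms : List (Move V)) : Prop :=
  ValidFrom edge K s ms ∧ Shadows c' (runMoves s ms) ∧ redCount (runMoves s ms) ≤ K

lemma Simulates.singleton {edge : V → V → Prop} {K : ℕ} {s c' : Config V} {m : Move V}
    (hl : legalMove edge s m) (hs : Shadows c' (applyMove s m))
    (hK : redCount (applyMove s m) ≤ K) : Simulates edge K s c' [m] :=
  ⟨⟨hl, hK, trivial⟩, hs, hK⟩

lemma Simulates.nil {edge : V → V → Prop} {K : ℕ} {s c' : Config V}
    (hs : Shadows c' s) (hK : redCount s ≤ K) : Simulates edge K s c' [] :=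
  ⟨trivial, hs, hK⟩

lemma Simulates.cons {edge : V → V → Prop} {K : ℕ} {s c' : Config V} {m : Move V}
    {ms : List (Move V)} (hl : legalMove edge s m) (hK : redCount (applyMove s m) ≤ K)
    (h : Simulates edge K (applyMove s m) c' ms) : Simulates edge K s c' (m :: ms) :=
  ⟨⟨hl, hK, h.1⟩, h.2⟩

/-- Blueing a red pebble of a configuration with at most `K + 1` red pebbles leaves at most `K`. -/
lemma redCount_put_blue_le {c : Config V} {K : ℕ} {h : V} (hh : c h = some Peb.red)
    (hc : redCount c ≤ K + 1) :
    redCount (c.put h (some Peb.blue)) ≤ K := by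
  have : redCount (c.put h (some Peb.blue)) < redCount c := by
    refine redCount_lt (fun v hv => ?_) hh (by simp)
    rcases eq_or_ne v h with rfl | hne
    · exact hh
    · simpa [hne] using hv
  omega

lemma exists_simulates_toRed {edge : V → V → Prop} {K : ℕ} {c s : Config V} {x : V}
    (hl : c x = some Peb.blue) (hc' : redCount (applyMove c (.toRed x)) ≤ K + 1)
    (hs : Shadows c s) (hK : redCount s ≤ K) :
    Simulates edge K s (applyMove c (.toRed x)) [] ∨
      Simulates edge K s (applyMove c (.toRed x)) [.toRed x] := by
  have hx : applyMove c (.toRed x) x = some Peb.red := by simp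
  rcases hs with rfl | ⟨h, hh, rfl⟩
  · by_cases hlt : redCount (applyMove s (.toRed x)) ≤ K
    · exact Or.inr (.singleton hl (Or.inl rfl) hlt)
    · refine Or.inl (.nil (Or.inr ⟨x, hx, ?_⟩) hK)
      simp [← hl]
  · have hne : h ≠ x := by rintro rfl; simp [hl] at hh
    have he : applyMove (c.put h (some Peb.blue)) (.toRed x) =
        (applyMove c (.toRed x)).put h (some Peb.blue) :=
      Config.put_comm hne _ _ _
    have hh' : applyMove c (.toRed x) h = some Peb.red := by simpa [hne] using hh
    refine Or.inr (.singleton ?_ (Or.inr ⟨h, hh', he⟩) ?_)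
    · simpa [legalMove, hne.symm] using hl
    · exact he ▸ redCount_put_blue_le hh' hc'

lemma exists_simulates_toBlue {edge : V → V → Prop} {K : ℕ} {c s : Config V} {x : V}
    (hl : c x = some Peb.red) (hs : Shadows c s) (hK : redCount s ≤ K) :
    Simulates edge K s (applyMove c (.toBlue x)) [] ∨
      Simulates edge K s (applyMove c (.toBlue x)) [.toBlue x] := by
  have hred : redCount (applyMove s (.toBlue x)) ≤ K := by
    refine (redCount_mono fun v hv => ?_).trans hK
    rcases eq_or_ne v x with rfl | hne
    · simp at hv
    · simpa [hne] using hv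
  rcases hs with rfl | ⟨h, hh, rfl⟩
  · exact Or.inr (.singleton hl (Or.inl rfl) hred)
  · rcases eq_or_ne h x with rfl | hne
    · exact Or.inl (.nil (Or.inl rfl) hK)
    · refine Or.inr (.singleton ?_ (Or.inr ⟨h, ?_, ?_⟩) hred)
      · simpa [legalMove, hne.symm] using hl
      · simpa [hne] using hh
      · exact Config.put_comm hne _ _ _

lemma simulates_delete {edge : V → V → Prop} {K : ℕ} {c s : Config V} {x : V}
    (hl : c x ≠ none) (hs : Shadows c s) (hK : redCount s ≤ K) :
    Simulates edge K s (applyMove c (.delete x)) [.delete x] := by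
  have hred : redCount (applyMove s (.delete x)) ≤ K := by
    refine (redCount_mono fun v hv => ?_).trans hK
    rcases eq_or_ne v x with rfl | hne
    · simp at hv
    · simpa [hne] using hv
  refine .singleton (hs.ne_none hl) ?_ hred
  rcases hs with rfl | ⟨h, hh, rfl⟩
  · exact Or.inl rfl
  · rcases eq_or_ne h x with rfl | hne
    · exact Or.inl (by simp)
    · refine Or.inr ⟨h, ?_, ?_⟩
      · simpa [hne] using hh
      · exact Config.put_comm hne _ _ _

/-- Computing `v` from `c` with one red pebble `w` of `c` away from `v` and its in-neighbors
turned blue. -/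
lemma simulates_compute_of_put {edge : V → V → Prop} {K : ℕ} {c : Config V} {v w : V}
    (hl : ∀ u, edge u v → c u = some Peb.red)
    (hc' : redCount (applyMove c (.compute v)) ≤ K + 1)
    (hw : c w = some Peb.red) (hwv : w ≠ v) (hew : ¬ edge w v) :
    Simulates edge K (c.put w (some Peb.blue)) (applyMove c (.compute v))
      [.compute v] := by
  have he : applyMove (c.put w (some Peb.blue)) (.compute v) =
      (applyMove c (.compute v)).put w (some Peb.blue) :=
    Config.put_comm hwv _ _ _
  have hw' : applyMove c (.compute v) w = some Peb.red := by simpa [hwv] using hw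
  refine .singleton (fun u hu => ?_) (Or.inr ⟨w, hw', he⟩) (he ▸ redCount_put_blue_le hw' hc')
  have hne : u ≠ w := by rintro rfl; exact hew hu
  simpa [hne] using hl u hu

/-- A computation of `v` is simulated with at most two additional transfers. -/
lemma exists_simulates_compute {edge : V → V → Prop} {K : ℕ} {c s : Config V} {v : V}
    (hdeg : indeg edge v + 1 ≤ K)
    (hl : ∀ u, edge u v → c u = some Peb.red)
    (hc' : redCount (applyMove c (.compute v)) ≤ K + 1)
    (hs : Shadows c s) (hK : redCount s ≤ K) :
    ∃ ms, Simulates edge K s (applyMove c (.compute v)) ms ∧ cost ms ≤ 2 ∧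
      ∀ u, ms.count (.compute u) ≤ [Move.compute v].count (.compute u) := by
  have hle : redCount c ≤ redCount (applyMove c (.compute v)) := by
    refine redCount_mono fun u hu => ?_
    rcases eq_or_ne u v with rfl | hne
    · simp
    · simpa [hne] using hu
  have hevict : K < redCount (applyMove c (.compute v)) →
      ∃ w, c w = some Peb.red ∧ w ≠ v ∧ ¬ edge w v := by
    intro hlt
    obtain ⟨w, hw, hwv, hew⟩ := exists_red_not_edge (hdeg.trans_lt hlt)
    exact ⟨w, by simpa [hwv] using hw, hwv, hew⟩
  rcases hs with rfl | ⟨h, hh, rfl⟩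
  · rcases le_or_gt (redCount (applyMove s (.compute v))) K with hlt | hgt
    · exact ⟨[.compute v], .singleton hl (Or.inl rfl) hlt, by simp [cost, isTransfer],
        fun _ => le_rfl⟩
    · obtain ⟨w, hw, hwv, hew⟩ := hevict hgt
      exact ⟨[.toBlue w, .compute v],
        .cons hw (redCount_put_blue_le hw (hle.trans hc'))
          (simulates_compute_of_put hl hc' hw hwv hew),
        by simp [cost, List.filter_cons, isTransfer], fun u => by simp [List.count_cons]⟩
  · rcases eq_or_ne h v with rfl | hhv
    · refine ⟨[], .nil (Or.inr ⟨h, by simp, by simp⟩) hK,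
        by simp [cost], fun u => by simp⟩
    by_cases heh : edge h v
    swap
    · exact ⟨[.compute v], simulates_compute_of_put hl hc' hh hhv heh,
        by simp [cost, isTransfer], fun _ => le_rfl⟩
    rcases le_or_gt (redCount (applyMove c (.compute v))) K with hlt | hgt
    · have he : applyMove (c.put h (some Peb.blue)) (.toRed h) = c := by
        simp [← hh]
      refine ⟨[.toRed h, .compute v], .cons (by simp [legalMove]) (he.symm ▸ hle.trans hlt) ?_,
        by simp [cost, List.filter_cons, isTransfer], fun u => by simp [List.count_cons]⟩
      exact he.symm ▸ .singleton hl (Or.inl rfl) hlt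
    · obtain ⟨w, hw, hwv, hew⟩ := hevict hgt
      have hwh : w ≠ h := by rintro rfl; exact hew heh
      have he : applyMove (applyMove (c.put h (some Peb.blue)) (.toBlue w))
          (.toRed h) = c.put w (some Peb.blue) := by
        funext u
        simp only [applyMove_toBlue, applyMove_toRed, Config.put_apply]
        grind
      refine ⟨[.toBlue w, .toRed h, .compute v], .cons ?_ ?_ (.cons ?_ ?_ ?_),
        by simp [cost, List.filter_cons, isTransfer], fun u => by simp [List.count_cons]⟩
      · simpa [legalMove, hwh] using hw
      · refine (redCount_mono fun u hu => ?_).trans hK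
        rcases eq_or_ne u w with rfl | hne
        · simp at hu
        · simpa [hne] using hu
      · simp [legalMove, hwh.symm]
      · exact he ▸ redCount_put_blue_le hw (hle.trans hc')
      · exact he.symm ▸ simulates_compute_of_put hl hc' hw hwv hew

/-- Every legal move with `K + 1` red pebbles is simulated with `K` red pebbles; only computations
incur additional cost, of at most two. -/
lemma exists_simulates_move {edge : V → V → Prop} {K : ℕ} (hdeg : ∀ v, indeg edge v + 1 ≤ K)
    {c s : Config V} {m : Move V} (hl : legalMove edge c m)
    (hc' : redCount (applyMove c m) ≤ K + 1) (hs : Shadows c s) (hK : redCount s ≤ K) :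
    ∃ ms, Simulates edge K s (applyMove c m) ms ∧ cost ms ≤ cost [m] + 2 * computeCount [m] ∧
      ∀ u, ms.count (.compute u) ≤ [m].count (.compute u) := by
  cases m with
  | toRed x =>
    rcases exists_simulates_toRed (edge := edge) hl hc' hs hK with h | h
    · exact ⟨_, h, by simp [cost], by simp⟩
    · exact ⟨_, h, by simp, fun _ => le_rfl⟩
  | toBlue x =>
    rcases exists_simulates_toBlue (edge := edge) hl hs hK with h | h
    · exact ⟨_, h, by simp [cost], by simp⟩
    · exact ⟨_, h, by simp, fun _ => le_rfl⟩
  | delete x => exact ⟨_, simulates_delete hl hs hK, by simp, fun _ => le_rfl⟩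
  | compute v =>
    obtain ⟨ms, h, hcost, hcount⟩ := exists_simulates_compute (hdeg v) hl hc' hs hK
    exact ⟨ms, h, hcost.trans (by simp [computeCount, List.filter_cons, isCompute]), hcount⟩

lemma exists_simulates {edge : V → V → Prop} {K : ℕ} (hdeg : ∀ v, indeg edge v + 1 ≤ K)
    {c s : Config V} {ms : List (Move V)} (hv : ValidFrom edge (K + 1) c ms)
    (hs : Shadows c s) (hK : redCount s ≤ K) :
    ∃ ms', Simulates edge K s (runMoves c ms) ms' ∧
      cost ms' ≤ cost ms + 2 * computeCount ms ∧
      ∀ u, ms'.count (.compute u) ≤ ms.count (.compute u) := by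
  induction ms generalizing c s with
  | nil => exact ⟨[], .nil hs hK, by simp, fun _ => le_rfl⟩
  | cons m ms ih =>
    obtain ⟨l₁, h₁, hcost₁, hcount₁⟩ := exists_simulates_move hdeg hv.1 hv.2.1 hs hK
    obtain ⟨l₂, h₂, hcost₂, hcount₂⟩ := ih hv.2.2 h₁.2.1 h₁.2.2
    refine ⟨l₁ ++ l₂, ⟨h₁.1.append h₂.1, ?_⟩, ?_, fun u => ?_⟩
    · rw [runMoves_append]
      exact h₂.2
    · rw [← List.singleton_append, cost_append, cost_append, computeCount_append]
      omega
    · rw [← List.singleton_append, List.count_append, List.count_append]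
      exact add_le_add (hcount₁ u) (hcount₂ u)

lemma computeCount_eq_sum (ms : List (Move V)) :
    computeCount ms = ∑ v, ms.count (.compute v) := by
  induction ms with
  | nil => simp [computeCount]
  | cons m ms ih =>
    rw [← List.singleton_append, computeCount_append, ih]
    simp only [List.count_append, Finset.sum_add_distrib]
    congr 1
    cases m <;> simp [computeCount, List.filter_cons, isCompute, List.count_cons]

lemma Oneshot.computeCount_le {ms : List (Move V)} (h : Oneshot ms) :
    computeCount ms ≤ Fintype.card V := by
  rw [computeCount_eq_sum]
  exact (Finset.sum_le_sum fun v _ => h v).trans (by simp)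

/-- In the oneshot model, if `R − 1 ≥ Δ + 1` then
`opt(R − 1) ≤ opt(R) + 2n`: reducing the number of available red pebbles by one
increases the optimal pebbling cost by at most `2n`. -/
theorem optCost_pred_le
    {V : Type} [Fintype V] [DecidableEq V] (edge : V → V → Prop)
    (hacyc : Acyclic edge) (Δ R : ℕ)
    (hΔ : ∀ v, indeg edge v ≤ Δ) (hR : Δ + 1 ≤ R - 1) :
    optCost edge (R - 1) ≤ optCost edge R + 2 * Fintype.card V := by
  obtain ⟨K, rfl⟩ : ∃ K, R = K + 1 := ⟨R - 1, by omega⟩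
  simp only [Nat.add_sub_cancel] at hR ⊢
  rcases Set.eq_empty_or_nonempty {c | ∃ moves : List (Move V),
    IsPebbling edge (K + 1) moves ∧ Oneshot moves ∧ cost moves = c} with hempty | hne
  · have hempty' : {c | ∃ moves : List (Move V),
        IsPebbling edge K moves ∧ Oneshot moves ∧ cost moves = c} = ∅ := by
      refine Set.eq_empty_of_subset_empty (hempty ▸ ?_)
      rintro c ⟨ms, hms, hrest⟩
      exact ⟨ms, ⟨hms.1.mono K.le_succ, hms.2⟩, hrest⟩
    simp [optCost, hempty']
  · obtain ⟨ms, ⟨hvalid, hsink⟩, hone, hcost⟩ := Nat.sInf_mem hne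
    obtain ⟨ms', hsim, hcost', hcount⟩ :=
      exists_simulates (fun v => (Nat.succ_le_succ (hΔ v)).trans hR) hvalid (Or.inl rfl)
        (by simp [redCount_initConfig])
    have hopt : optCost edge K ≤ cost ms' :=
      Nat.sInf_le ⟨ms', ⟨hsim.1, fun v hv => hsim.2.1.ne_none (hsink v hv)⟩,
        fun v => (hcount v).trans (hone v), rfl⟩
    have hn := hone.computeCount_le
    change cost ms = optCost edge (K + 1) at hcost
    omega

end RBPebble
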